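/- Suppose T is disjoint from its image under the involution * (i.e. T ∩ T* = ∅) and σ₁ ∈ T. Then a_j = a_T/f for every 1 ≤ j ≤ n−1 and a_n = (a_T + 1)/f; that is, the μ-ordinary slopes attached to T are a_T/f with multiplicity (n−1)f and (a_T + 1)/f with multiplicity f. -/

import Mathlib

/-- The composite `σ* = conj ∘ σ` of a complex embedding with complex conjugation. -/
def conjEmb {F : Type*} [Field F] (σ : F →+* ℂ) : F →+* ℂ :=
  (starRingEnd ℂ).comp σ

theorem conjEmb_conjEmb {F : Type*} [Field F] (σ : F →+* ℂ) : conjEmb (conjEmb σ) = σ := by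
  ext x
  simp [conjEmb]

/-- Let `F` be a totally complex number field, `Φ` a CM type of `F`,
`σ₁ ∈ Φ`, `n ≥ 1`, and let `𝔣` be the simple signature.  Let `T` be a nonempty finite set of
complex embeddings of `F` of cardinality `f` with `T ∩ T* = ∅` and `σ₁ ∈ T`.  Writing
`a_T = #(Φ* ∩ T)`, the μ-ordinary slopes `a_j = #{σ ∈ T : 𝔣(σ) > n − j} / f` attached to `T`
satisfy `a_j = a_T / f` for `1 ≤ j ≤ n−1` and `a_n = (a_T + 1)/f`; i.e. the slopes are
`a_T/f` with multiplicity `(n−1)f` and `(a_T+1)/f` with multiplicity `f`. -/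
theorem stmt_4 (F : Type*) [Field F] [NumberField F] [DecidableEq (F →+* ℂ)]
    (htc : ∀ σ : F →+* ℂ, conjEmb σ ≠ σ)
    (Φ : Finset (F →+* ℂ))
    (hΦ : ∀ σ : F →+* ℂ, Xor' (σ ∈ Φ) (conjEmb σ ∈ Φ))
    (σ₁ : F →+* ℂ) (hσ₁ : σ₁ ∈ Φ)
    (n : ℕ) (hn : 1 ≤ n)
    (𝔣 : (F →+* ℂ) → ℤ)
    (h𝔣σ₁ : 𝔣 σ₁ = 1)
    (h𝔣Φ : ∀ σ ∈ Φ, σ ≠ σ₁ → 𝔣 σ = 0)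
    (h𝔣σ₁c : 𝔣 (conjEmb σ₁) = (n : ℤ) - 1)
    (h𝔣Φc : ∀ σ ∈ Φ, σ ≠ σ₁ → 𝔣 (conjEmb σ) = (n : ℤ))
    (T : Finset (F →+* ℂ)) (hT : T.Nonempty) (f : ℕ) (hf : T.card = f)
    (hTdisj : T ∩ T.image conjEmb = ∅)
    (hσ₁T : σ₁ ∈ T) :
    (∀ j : ℕ, 1 ≤ j → j ≤ n - 1 →
      (((T.filter fun σ => (n : ℤ) - (j : ℤ) < 𝔣 σ).card : ℚ) / (f : ℚ)) =
        ((Φ.image conjEmb ∩ T).card : ℚ) / (f : ℚ)) ∧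
    (((T.filter fun σ => (n : ℤ) - (n : ℤ) < 𝔣 σ).card : ℚ) / (f : ℚ)) =
      (((Φ.image conjEmb ∩ T).card : ℚ) + 1) / (f : ℚ) := by
  have hmem : ∀ σ, σ ∈ Φ.image conjEmb ↔ σ ∉ Φ := by
    intro σ
    rw [Finset.mem_image]
    constructor
    · rintro ⟨τ, hτ, rfl⟩ h
      rcases hΦ τ with h' | h'
      · exact h'.2 h
      · exact h'.2 hτ
    · intro h
      rcases hΦ σ with h' | h'
      · exact absurd h'.1 h
      · exact ⟨conjEmb σ, h'.1, conjEmb_conjEmb σ⟩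
  have h𝔣T : ∀ σ ∈ T, σ ∉ Φ → 𝔣 σ = n := by
    intro σ hσT hσ
    obtain ⟨τ, hτ, rfl⟩ := Finset.mem_image.mp ((hmem σ).mpr hσ)
    refine h𝔣Φc τ hτ ?_
    rintro rfl
    have : conjEmb τ ∈ T ∩ T.image conjEmb :=
      Finset.mem_inter.mpr ⟨hσT, Finset.mem_image_of_mem _ hσ₁T⟩
    simp [hTdisj] at this
  refine ⟨fun j hj hjn => ?_, ?_⟩
  · congr 3
    ext σ
    rw [Finset.mem_filter, Finset.mem_inter, hmem, and_comm]
    refine and_congr_left fun hσT => ?_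
    by_cases hσ : σ ∈ Φ
    · by_cases h : σ = σ₁
      · subst h
        simp only [hσ, not_true_eq_false, iff_false]
        omega
      · have := h𝔣Φ σ hσ h
        simp only [hσ, not_true_eq_false, iff_false]
        omega
    · have := h𝔣T σ hσT hσ
      simp only [hσ, not_false_eq_true, iff_true]
      omega
  · have hfilter : (T.filter fun σ => (n : ℤ) - (n : ℤ) < 𝔣 σ) =
        insert σ₁ (Φ.image conjEmb ∩ T) := by
      ext σ
      rw [Finset.mem_filter, Finset.mem_insert, Finset.mem_inter, hmem]
      by_cases h : σ = σ₁
      · subst h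
        simp [hσ₁T, h𝔣σ₁]
      · by_cases hσ : σ ∈ Φ
        · simp [h, hσ, h𝔣Φ σ hσ h]
        · simp only [h, hσ, false_or, not_false_eq_true, true_and, and_iff_left_iff_imp]
          intro hσT
          have := h𝔣T σ hσT hσ
          omega
    have hnot : σ₁ ∉ Φ.image conjEmb ∩ T := fun h =>
      (hmem σ₁).mp (Finset.mem_inter.mp h).1 hσ₁
    rw [hfilter, Finset.card_insert_of_notMem hnot]
    push_cast
    rfl
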